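/- arXiv:2212.03982 — 2 statements merged into one kernel-verified Lean document; each statement's English description precedes it below -/
import Mathlib

section
/- Let U ⊆ ℝ^m be an open set, let k ≥ m, and let F : U × (−1,1) → ℝ^k be a smooth (C^∞) map. Suppose that for every (x₀,t₀) ∈ U × (−1,1) the partial derivatives ∂F/∂x₁(x₀,t₀), …, ∂F/∂x_m(x₀,t₀) are linearly independent in ℝ^k, and the partial derivative ∂F/∂t(x₀,t₀) lies in the linear span of ∂F/∂x₁(x₀,t₀), …, ∂F/∂x_m(x₀,t₀). Then for every open set U′ whose closure is compact and contained in U, there exist ε ∈ (0,1) and a smooth map φ : U′ × (−ε,ε) → U such that φ(x,0) = x for all x ∈ U′ and F(x,t) = F(φ(x,t), 0) for all x ∈ U′ and all t with |t| < ε. -/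
open scoped ContDiff
open Set Function

noncomputable section

/-- Euclidean space `ℝ^n`. -/
abbrev E (n : ℕ) : Type := EuclideanSpace ℝ (Fin n)

open Filter Topology

/-- A linear map is injective when the images of the standard basis vectors are independent. -/
lemma injective_of_linearIndependent_single {m k : ℕ} (A : E m →L[ℝ] E k)
    (h : LinearIndependent ℝ (fun i : Fin m => A (EuclideanSpace.single i 1))) :
    Injective A := by
  have hb : LinearIndependent ℝ (A.toLinearMap ∘ (EuclideanSpace.basisFun (Fin m) ℝ).toBasis) := by
    convert h using 2
    simp
  refine (injective_iff_map_eq_zero A).2 fun v hv => ?_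
  have hv' := (EuclideanSpace.basisFun (Fin m) ℝ).toBasis.sum_repr v
  rw [← hv'] at hv
  rw [map_sum] at hv
  simp only [map_smul] at hv
  have := Fintype.linearIndependent_iff.1 hb _ hv
  rw [← hv']
  exact Finset.sum_eq_zero fun i _ => by rw [this i, zero_smul]

/-- If `∂F/∂t` lies in the span of the `∂F/∂xᵢ`, it is a directional derivative along `E m`. -/
lemma exists_apply_eq_of_mem_span {m k : ℕ} (A : E m × ℝ →L[ℝ] E k)
    (h : A (0, 1) ∈ Submodule.span ℝ
      (Set.range fun i : Fin m => A (EuclideanSpace.single i 1, 0))) :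
    ∃ u : E m, A (u, 0) = A (0, 1) := by
  have : Submodule.span ℝ (Set.range fun i : Fin m => A (EuclideanSpace.single i 1, 0)) ≤
      LinearMap.range (A.comp (ContinuousLinearMap.inl ℝ (E m) ℝ)).toLinearMap := by
    rw [Submodule.span_le]
    rintro _ ⟨i, rfl⟩
    exact ⟨EuclideanSpace.single i 1, by simp⟩
  obtain ⟨u, hu⟩ := this h
  exact ⟨u, by simpa using hu⟩

/-- An injective endomorphism of `E m × ℝ` is a continuous linear equivalence. -/
lemma mem_range_coe_of_injective {m : ℕ} (B : E m × ℝ →L[ℝ] E m × ℝ) (h : Injective B) :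
    B ∈ Set.range ((↑) : ((E m × ℝ) ≃L[ℝ] (E m × ℝ)) → (E m × ℝ →L[ℝ] E m × ℝ)) :=
  ⟨(LinearEquiv.ofInjectiveEndo B.toLinearMap h).toContinuousLinearEquiv, by ext <;> rfl⟩

lemma continuousOn_clm_prod {X V₁ V₂ V₃ : Type*} [TopologicalSpace X]
    [NormedAddCommGroup V₁] [NormedSpace ℝ V₁] [NormedAddCommGroup V₂] [NormedSpace ℝ V₂]
    [NormedAddCommGroup V₃] [NormedSpace ℝ V₃] {s : Set X}
    {f : X → V₁ →L[ℝ] V₂} {g : X → V₁ →L[ℝ] V₃} (hf : ContinuousOn f s) (hg : ContinuousOn g s) :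
    ContinuousOn (fun x => (f x).prod (g x)) s :=
  (ContinuousLinearMap.prodₗᵢ (𝕜 := ℝ) (E := V₁) (F := V₂) (G := V₃) ℝ).continuous.comp_continuousOn
    (hf.prodMk hg)

/-- The inverse function theorem, with the source shrunk into a prescribed neighbourhood. -/
lemma exists_openPartialHomeomorph_source_subset {V : Type*} [NormedAddCommGroup V]
    [NormedSpace ℝ V] [CompleteSpace V] {f : V → V} {p : V} {B : V ≃L[ℝ] V}
    (hf : ContDiffAt ℝ ∞ f p) (hd : HasFDerivAt f (B : V →L[ℝ] V) p)
    {N : Set V} (hN : IsOpen N) (hp : p ∈ N) :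
    ∃ e : OpenPartialHomeomorph V V, ⇑e = f ∧ p ∈ e.source ∧ e.source ⊆ N :=
  ⟨(hf.toOpenPartialHomeomorph f hd (by simp)).restrOpen N hN, rfl,
    ⟨hf.mem_toOpenPartialHomeomorph_source hd (by simp), hp⟩, fun _ h => h.2⟩

/-- Near a point of the slice `t = 0`, a smooth map whose `t`-derivative is tangent to its slices
is a reparametrization of its slice at `t = 0`, which is itself injective there. -/
lemma exists_local_reparametrization {m k : ℕ}
    {U : Set (E m)} (hU : IsOpen U) {F : E m × ℝ → E k}
    (hF : ContDiffOn ℝ ∞ F (U ×ˢ Set.Ioo (-1 : ℝ) 1))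
    (hind : ∀ x₀ ∈ U, ∀ t₀ ∈ Set.Ioo (-1 : ℝ) 1,
      LinearIndependent ℝ
        (fun i : Fin m => fderiv ℝ F (x₀, t₀) (EuclideanSpace.single i 1, 0)))
    (hspan : ∀ x₀ ∈ U, ∀ t₀ ∈ Set.Ioo (-1 : ℝ) 1,
      fderiv ℝ F (x₀, t₀) (0, 1) ∈
        Submodule.span ℝ
          (Set.range fun i : Fin m => fderiv ℝ F (x₀, t₀) (EuclideanSpace.single i 1, 0)))
    {x₀ : E m} (hx₀ : x₀ ∈ U) :
    (∃ ψ : E m × ℝ → E m, ψ (x₀, 0) = x₀ ∧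
      ∀ᶠ p in 𝓝 (x₀, (0 : ℝ)), ContDiffAt ℝ ∞ ψ p ∧ F p = F (ψ p, 0)) ∧
    ∃ W : Set (E m), IsOpen W ∧ x₀ ∈ W ∧ W ⊆ U ∧ InjOn (fun x => F (x, 0)) W := by
  set Ω : Set (E m × ℝ) := U ×ˢ Set.Ioo (-1 : ℝ) 1 with hΩ
  have hΩo : IsOpen Ω := hU.prod isOpen_Ioo
  have hp₀ : (x₀, (0 : ℝ)) ∈ Ω := ⟨hx₀, by norm_num⟩
  have hFat : ∀ p ∈ Ω, ContDiffAt ℝ ∞ F p := fun p hp => hF.contDiffAt (hΩo.mem_nhds hp)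
  obtain ⟨L, hL⟩ : ∃ L : E k →L[ℝ] E m, ∀ v, L (fderiv ℝ F (x₀, 0) (v, 0)) = v := by
    set A := (fderiv ℝ F (x₀, 0)).comp (ContinuousLinearMap.inl ℝ (E m) ℝ) with hA
    have hAinj : Injective A := injective_of_linearIndependent_single A (by
      simpa [hA] using hind x₀ hx₀ 0 (by norm_num))
    obtain ⟨g, hg⟩ := A.toLinearMap.exists_leftInverse_of_injective (LinearMap.ker_eq_bot.2 hAinj)
    refine ⟨LinearMap.toContinuousLinearMap g, fun v => ?_⟩
    simpa [hA] using LinearMap.congr_fun hg v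
  set Φ : E m × ℝ → E m × ℝ := fun p => (L (F p), p.2) with hΦ
  set Φ' : E m × ℝ → (E m × ℝ →L[ℝ] E m × ℝ) := fun p =>
    (L.comp (fderiv ℝ F p)).prod (ContinuousLinearMap.snd ℝ (E m) ℝ) with hΦ'
  have hΦsm : ∀ p ∈ Ω, ContDiffAt ℝ ∞ Φ p := fun p hp =>
    (L.contDiff.contDiffAt.comp p (hFat p hp)).prodMk contDiffAt_snd
  have hΦd : ∀ p ∈ Ω, HasFDerivAt Φ (Φ' p) p := fun p hp =>
    (L.hasFDerivAt.comp p ((hFat p hp).differentiableAt (by simp)).hasFDerivAt).prodMk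
      hasFDerivAt_snd
  set R := Set.range ((↑) : ((E m × ℝ) ≃L[ℝ] (E m × ℝ)) → (E m × ℝ →L[ℝ] E m × ℝ)) with hR
  have hp₀R : Φ' (x₀, 0) ∈ R := by
    refine mem_range_coe_of_injective _ ((injective_iff_map_eq_zero _).2 ?_)
    rintro ⟨v, s⟩ h
    have h2 : s = 0 := by simpa [hΦ'] using congrArg Prod.snd h
    subst h2
    have h1 := congrArg Prod.fst h
    simp only [hΦ', ContinuousLinearMap.prod_apply, ContinuousLinearMap.comp_apply, hL,
      Prod.fst_zero] at h1
    simp [h1]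
  have hΦ'c : ContinuousOn Φ' Ω := by
    have h1 : ContinuousOn (fderiv ℝ F) Ω := hF.continuousOn_fderiv_of_isOpen hΩo (by simp)
    have h2 : ContinuousOn (fun p => L.comp (fderiv ℝ F p)) Ω := continuousOn_const.clm_comp h1
    exact continuousOn_clm_prod h2 continuousOn_const
  set N : Set (E m × ℝ) := Ω ∩ Φ' ⁻¹' R with hN
  have hNo : IsOpen N := hΦ'c.isOpen_inter_preimage hΩo ContinuousLinearEquiv.isOpen
  have hp₀N : (x₀, (0 : ℝ)) ∈ N := ⟨hp₀, hp₀R⟩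
  obtain ⟨B₀, hB₀⟩ := hp₀R
  have hd₀ : HasFDerivAt Φ (B₀ : E m × ℝ →L[ℝ] E m × ℝ) (x₀, 0) := hB₀ ▸ hΦd _ hp₀
  obtain ⟨e, hecoe, hp₀e, heN⟩ :=
    exists_openPartialHomeomorph_source_subset (hΦsm _ hp₀) hd₀ hNo hp₀N
  have hesymm : ∀ q ∈ e.target, ContDiffAt ℝ ∞ e.symm q := by
    intro q hq
    have hs := heN (e.map_target hq)
    obtain ⟨B, hB⟩ := hs.2
    exact e.contDiffAt_symm (f₀' := B) hq (by rw [hecoe, hB]; exact hΦd _ hs.1)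
      (by rw [hecoe]; exact hΦsm _ hs.1)
  have hright : ∀ q ∈ e.target, Φ (e.symm q) = q := fun q hq => by
    rw [← hecoe, e.right_inv hq]
  have hsnd : ∀ q ∈ e.target, (e.symm q).2 = q.2 := fun q hq =>
    show (Φ (e.symm q)).2 = q.2 from congrArg Prod.snd (hright q hq)
  set z₀ := L (F (x₀, 0)) with hz₀
  have hz₀T : (z₀, (0 : ℝ)) ∈ e.target := by
    have := e.map_source hp₀e
    rwa [hecoe] at this
  obtain ⟨r, hr, hrT⟩ := Metric.isOpen_iff.1 e.open_target _ hz₀T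
  have hdH : ∀ q ∈ e.target, HasDerivAt (fun t => F (e.symm (q.1, t))) 0 q.2 := by
    intro q hq
    have hs := heN (e.map_target hq)
    obtain ⟨B, hB⟩ := hs.2
    have hes : HasFDerivAt e.symm (B.symm : E m × ℝ →L[ℝ] E m × ℝ) q :=
      e.hasFDerivAt_symm hq (by rw [hecoe, hB]; exact hΦd _ hs.1)
    have hH := (((hFat _ hs.1).differentiableAt (by simp)).hasFDerivAt).comp q hes
    have hc : HasDerivAt (fun t : ℝ => (q.1, t)) ((0 : E m), (1 : ℝ)) q.2 :=
      (hasDerivAt_const _ _).prodMk (hasDerivAt_id _)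
    have hd := HasFDerivAt.comp_hasDerivAt q.2 (show HasFDerivAt _ _ (q.1, q.2) from hH) hc
    refine hd.congr_deriv ?_
    set w := B.symm ((0 : E m), (1 : ℝ)) with hw
    have hBw : Φ' (e.symm q) w = (0, 1) := by
      rw [← hB, hw]; exact B.apply_symm_apply _
    obtain ⟨u, hu⟩ := exists_apply_eq_of_mem_span (fderiv ℝ F (e.symm q))
      (hspan _ hs.1.1 _ hs.1.2)
    have hw2 : w.2 = 1 := by simpa [hΦ'] using congrArg Prod.snd hBw
    have hw1 : L (fderiv ℝ F (e.symm q) w) = 0 := by simpa [hΦ'] using congrArg Prod.fst hBw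
    have hsplit : fderiv ℝ F (e.symm q) w = fderiv ℝ F (e.symm q) (w.1 + u, 0) := by
      have h1 : w = (w.1, 0) + (0, 1) := by ext <;> simp [hw2]
      have h2 : (w.1 + u, (0 : ℝ)) = (w.1, 0) + (u, 0) := by simp
      rw [h2, map_add, hu, ← map_add, ← h1]
    have hzero : (w.1 + u, (0 : ℝ)) = 0 := by
      apply B.injective
      have : Φ' (e.symm q) (w.1 + u, 0) = 0 := by
        rw [hsplit] at hw1
        ext1
        · exact hw1
        · rfl
      rw [map_zero, ← this, ← hB]; rfl
    change fderiv ℝ F (e.symm q) w = 0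
    rw [hsplit, hzero, map_zero]
  have hconst : ∀ q ∈ Metric.ball (z₀, (0 : ℝ)) r, F (e.symm q) = F (e.symm (q.1, 0)) := by
    rintro ⟨z, t⟩ hq
    rw [← ball_prod_same] at hq
    have hmem : ∀ s ∈ Metric.ball (0 : ℝ) r, (z, s) ∈ e.target := fun s hs =>
      hrT (by rw [← ball_prod_same]; exact ⟨hq.1, hs⟩)
    exact Metric.isOpen_ball.is_const_of_deriv_eq_zero
      (f := fun s => F (e.symm (z, s))) (convex_ball (0 : ℝ) r).isPreconnected
      (fun s hs => (hdH (z, s) (hmem s hs)).differentiableAt.differentiableWithinAt)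
      (fun s hs => (hdH (z, s) (hmem s hs)).deriv) hq.2 (Metric.mem_ball_self hr)
  refine ⟨⟨fun p => (e.symm (L (F p), 0)).1, ?_, ?_⟩, ?_⟩
  · have := e.left_inv hp₀e
    rw [hecoe] at this
    exact congrArg Prod.fst this
  · have hΦc : ContinuousAt Φ (x₀, 0) := (hΦsm _ hp₀).continuousAt
    filter_upwards [e.open_source.mem_nhds hp₀e,
      hΦc.preimage_mem_nhds (Metric.ball_mem_nhds (z₀, (0 : ℝ)) hr)] with p hp hpb
    have hpΩ := (heN hp).1
    have hpb' : (L (F p), (0 : ℝ)) ∈ Metric.ball (z₀, (0 : ℝ)) r := by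
      have hpb2 : (L (F p), p.2) ∈ Metric.ball (z₀, (0 : ℝ)) r := hpb
      rw [← ball_prod_same] at hpb2 ⊢
      exact ⟨hpb2.1, Metric.mem_ball_self hr⟩
    have hq := hrT hpb'
    constructor
    · exact contDiffAt_fst.comp p ((hesymm _ hq).comp p
        ((L.contDiff.contDiffAt.comp p (hFat p hpΩ)).prodMk contDiffAt_const))
    · calc F p = F (e.symm (Φ p)) := by rw [← hecoe, e.left_inv hp]
        _ = F (e.symm (L (F p), 0)) := hconst _ hpb
        _ = F ((e.symm (L (F p), 0)).1, 0) := by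
          congr 1
          exact Prod.ext rfl (hsnd _ hq)
  · refine ⟨(fun x => (x, (0 : ℝ))) ⁻¹' e.source, e.open_source.preimage (by fun_prop), hp₀e,
      fun x hx => (heN hx).1.1, fun x hx y hy hxy => ?_⟩
    have : Φ (x, 0) = Φ (y, 0) := by
      simp only [hΦ]
      rw [show F (x, 0) = F (y, 0) from hxy]
    exact congrArg Prod.fst (e.injOn hx hy (by rw [hecoe, this]))

/-- **Deformation along tangent directions, one-parameter case.**
Let `U ⊆ ℝ^m` be open, `k ≥ m`, and `F : U × (−1,1) → ℝ^k` smooth. Suppose that at every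
point of `U × (−1,1)` the partial derivatives `∂F/∂x₁, …, ∂F/∂x_m` are linearly independent
and `∂F/∂t` lies in their span. Then for every open `U′` with compact closure contained in
`U`, there are `ε ∈ (0,1)` and a smooth map `φ : U′ × (−ε,ε) → U` with `φ(x,0) = x` and
`F(x,t) = F(φ(x,t), 0)` for all `x ∈ U′`, `|t| < ε`. -/
theorem deformation_along_tangent_directions {m k : ℕ} (hmk : m ≤ k)
    (U : Set (E m)) (hU : IsOpen U) (F : E m × ℝ → E k)
    (hF : ContDiffOn ℝ ∞ F (U ×ˢ Set.Ioo (-1 : ℝ) 1))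
    (hind : ∀ x₀ ∈ U, ∀ t₀ ∈ Set.Ioo (-1 : ℝ) 1,
      LinearIndependent ℝ
        (fun i : Fin m => fderiv ℝ F (x₀, t₀) (EuclideanSpace.single i 1, 0)))
    (hspan : ∀ x₀ ∈ U, ∀ t₀ ∈ Set.Ioo (-1 : ℝ) 1,
      fderiv ℝ F (x₀, t₀) (0, 1) ∈
        Submodule.span ℝ
          (Set.range fun i : Fin m => fderiv ℝ F (x₀, t₀) (EuclideanSpace.single i 1, 0))) :
    ∀ U' : Set (E m), IsOpen U' → IsCompact (closure U') → closure U' ⊆ U →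
      ∃ ε ∈ Set.Ioo (0 : ℝ) 1, ∃ φ : E m × ℝ → E m,
        ContDiffOn ℝ ∞ φ (U' ×ˢ Set.Ioo (-ε) ε) ∧
        (∀ x ∈ U', φ (x, 0) = x) ∧
        (∀ x ∈ U', ∀ t : ℝ, |t| < ε →
          φ (x, t) ∈ U ∧ F (x, t) = F (φ (x, t), 0)) := by
  intro U' hU' hK hKU
  have hloc := fun x hx => exists_local_reparametrization hU hF hind hspan (x₀ := x) hx
  choose! W hWo hxW hWU hWinj using fun x hx => (hloc x hx).2
  obtain ⟨δ, hδ, hδW⟩ := lebesgue_number_lemma_of_metric (c := fun x : U => W x) hK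
    (fun x => hWo _ x.2) (fun x hx => mem_iUnion.2 ⟨⟨x, hKU hx⟩, hxW x (hKU hx)⟩)
  have hballU : ∀ x ∈ closure U', Metric.ball x δ ⊆ U := fun x hx => by
    obtain ⟨i, hi⟩ := hδW x hx
    exact hi.trans (hWU _ i.2)
  have hinj : ∀ x ∈ closure U', InjOn (fun y => F (y, 0)) (Metric.ball x δ) := fun x hx => by
    obtain ⟨i, hi⟩ := hδW x hx
    exact (hWinj _ i.2).mono hi
  set O : Set (E m × ℝ) := interior {p | ∃ ψ : E m × ℝ → E m, ContDiffAt ℝ ∞ ψ p ∧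
    ∀ᶠ q in 𝓝 p, ψ q ∈ Metric.ball q.1 δ ∧ F (ψ q, 0) = F q} with hO
  have hKO : closure U' ×ˢ {(0 : ℝ)} ⊆ O := by
    rintro ⟨x, t⟩ ⟨hx, rfl : t = 0⟩
    obtain ⟨ψ, hψx, hψ⟩ := (hloc x (hKU hx)).1
    have hψc : ContinuousAt ψ (x, 0) := hψ.self_of_nhds.1.continuousAt
    have hdist : ∀ᶠ q in 𝓝 (x, (0 : ℝ)), dist (ψ q) q.1 < δ :=
      (hψc.dist continuousAt_fst).eventually_lt continuousAt_const (by simpa [hψx] using hδ)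
    rw [hO, mem_interior_iff_mem_nhds]
    filter_upwards [hψ, (hψ.and hdist).eventually_nhds] with p hp hp'
    exact ⟨ψ, hp.1, hp'.mono fun q hq => ⟨hq.2, hq.1.2.symm⟩⟩
  obtain ⟨u, v, -, hv, hKu, h0v, huv⟩ :=
    generalized_tube_lemma hK isCompact_singleton isOpen_interior hKO
  obtain ⟨r, hr, hrv⟩ := Metric.isOpen_iff.1 hv 0 (h0v rfl)
  have hmemO : ∀ x ∈ U', ∀ t : ℝ, |t| < min r (1 / 2) → (x, t) ∈ O := fun x hx t ht =>
    huv ⟨hKu (subset_closure hx), hrv (by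
      simpa using ht.trans_le (min_le_left _ _))⟩
  classical
  let φ : E m × ℝ → E m := fun p =>
    if h : ∃ y ∈ Metric.ball p.1 δ, F (y, 0) = F p then h.choose else p.1
  have hφeq : ∀ p : E m × ℝ, p.1 ∈ U' → ∀ y ∈ Metric.ball p.1 δ, F (y, 0) = F p → φ p = y := by
    intro p hp y hy hyF
    have h : ∃ y ∈ Metric.ball p.1 δ, F (y, 0) = F p := ⟨y, hy, hyF⟩
    simp only [φ, dif_pos h]
    exact hinj p.1 (subset_closure hp) h.choose_spec.1 hy (h.choose_spec.2.trans hyF.symm)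
  refine ⟨min r (1 / 2), ⟨by positivity, (min_le_right _ _).trans_lt (by norm_num)⟩, φ, ?_, ?_, ?_⟩
  · rintro ⟨x, t⟩ ⟨hx, ht⟩
    obtain ⟨ψ, hψs, hψ⟩ := interior_subset (hmemO x hx t (abs_lt.2 ht))
    refine (hψs.congr_of_eventuallyEq ?_).contDiffWithinAt
    filter_upwards [hψ, continuousAt_fst.preimage_mem_nhds (hU'.mem_nhds hx)] with q hq hqU
    exact hφeq q hqU _ hq.1 hq.2
  · exact fun x hx => hφeq (x, 0) hx x (Metric.mem_ball_self hδ) rfl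
  · intro x hx t ht
    obtain ⟨ψ, -, hψ⟩ := interior_subset (hmemO x hx t ht)
    obtain ⟨hb, hFe⟩ := hψ.self_of_nhds
    rw [hφeq (x, t) hx _ hb hFe]
    exact ⟨hballU x (subset_closure hx) hb, hFe.symm⟩
end
end

section
/- Let U ⊆ ℝ^m be an open set, let k ≥ m, let l ≥ 1, and let F : U × (−1,1)^l → ℝ^k be a smooth (C^∞) map. Suppose that for every (x₀,t₀) ∈ U × (−1,1)^l the partial derivatives ∂F/∂x₁(x₀,t₀), …, ∂F/∂x_m(x₀,t₀) are linearly independent in ℝ^k, and for each j = 1, …, l the partial derivative ∂F/∂t^j(x₀,t₀) lies in the linear span of ∂F/∂x₁(x₀,t₀), …, ∂F/∂x_m(x₀,t₀). Then for every open set U′ whose closure is compact and contained in U, there exist ε ∈ (0,1) and a smooth map φ : U′ × {t ∈ ℝ^l : |t| < ε} → U such that φ(x,0) = x for all x ∈ U′ and F(x,t) = F(φ(x,t), 0) for all x ∈ U′ and all t ∈ (−1,1)^l with |t| < ε. -/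
open scoped ContDiff
open Set Function

noncomputable section

section TangentDeformation

open Filter Topology

variable {X T G : Type*} [NormedAddCommGroup X] [NormedSpace ℝ X] [FiniteDimensional ℝ X]
  [NormedAddCommGroup T] [NormedSpace ℝ T] [FiniteDimensional ℝ T]
  [NormedAddCommGroup G] [NormedSpace ℝ G]

theorem exists_continuousLinearEquiv_prod_snd (B : X × T →L[ℝ] X)
    (hB : Injective (B.comp (ContinuousLinearMap.inl ℝ X T))) :
    ∃ e : (X × T) ≃L[ℝ] (X × T),
      (e : X × T →L[ℝ] X × T) = B.prod (ContinuousLinearMap.snd ℝ X T) := by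
  have hinj : Injective (B.prod (ContinuousLinearMap.snd ℝ X T)) := by
    rintro ⟨x, t⟩ ⟨y, s⟩ h
    simp only [ContinuousLinearMap.prod_apply, ContinuousLinearMap.coe_snd', Prod.mk.injEq] at h
    obtain ⟨h, rfl⟩ := h
    have h0 : B (x - y, 0) = 0 := by
      rw [show ((x - y, 0) : X × T) = (x, t) - (y, t) by simp, map_sub, h, sub_self]
    have : x - y = 0 := hB (h0.trans (map_zero _).symm)
    rw [sub_eq_zero.1 this]
  refine ⟨(LinearEquiv.ofInjectiveEndo
    (B.prod (ContinuousLinearMap.snd ℝ X T)).toLinearMap hinj).toContinuousLinearEquiv, ?_⟩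
  ext x <;> rfl

/-- Constant rank normal form: if the `T`-derivatives of `F` lie in the span of the `X`-derivatives,
which are independent, then near `(x₀, t₀)` the map `F` is a reparametrization of `F (·, t₀)`. -/
theorem exists_local_reparametrization_s1 [FiniteDimensional ℝ G] {Ω : Set (X × T)} (hΩ : IsOpen Ω)
    {F : X × T → G} (hF : ContDiffOn ℝ ∞ F Ω)
    (hinj : ∀ p ∈ Ω, Injective ((fderiv ℝ F p).comp (ContinuousLinearMap.inl ℝ X T)))
    (htan : ∀ p ∈ Ω, ∀ τ : T, ∃ ξ : X, fderiv ℝ F p (0, τ) = fderiv ℝ F p (ξ, 0))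
    {x₀ : X} {t₀ : T} (hp₀ : (x₀, t₀) ∈ Ω) :
    (∃ V ∈ 𝓝 x₀, InjOn (fun x => F (x, t₀)) V) ∧
    ∃ ψ : X × T → X, ψ (x₀, t₀) = x₀ ∧
      ∀ᶠ p in 𝓝 (x₀, t₀), ContDiffAt ℝ ∞ ψ p ∧ F (ψ p, t₀) = F p := by
  have hFat : ∀ p ∈ Ω, ContDiffAt ℝ ∞ F p := fun p hp => hF.contDiffAt (hΩ.mem_nhds hp)
  have hFdiff : ∀ p ∈ Ω, HasFDerivAt F (fderiv ℝ F p) p := fun p hp =>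
    ((hFat p hp).differentiableAt (by simp)).hasFDerivAt
  obtain ⟨P', hP'⟩ := LinearMap.exists_leftInverse_of_injective
    ((fderiv ℝ F (x₀, t₀)).comp (ContinuousLinearMap.inl ℝ X T)).toLinearMap
    (LinearMap.ker_eq_bot.2 (hinj _ hp₀))
  let P : G →L[ℝ] X := LinearMap.toContinuousLinearMap P'
  let B : X × T → (X × T →L[ℝ] X) := fun p => P.comp (fderiv ℝ F p)
  let Ψ : X × T → X × T := fun p => (P (F p), p.2)
  let good : Set (X × T) := {p | p ∈ Ω ∧ Injective ((B p).comp (ContinuousLinearMap.inl ℝ X T))}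
  have hgood₀ : (x₀, t₀) ∈ good := by
    refine ⟨hp₀, LeftInverse.injective (g := id) fun x => ?_⟩
    exact LinearMap.congr_fun hP' x
  have hgood : good ∈ 𝓝 (x₀, t₀) := by
    have hc : ContinuousAt (fun p => (B p).comp (ContinuousLinearMap.inl ℝ X T)) (x₀, t₀) := by
      have : ContinuousAt (fderiv ℝ F) (x₀, t₀) :=
        ((hFat _ hp₀).fderiv_right (m := 0) (by simp)).continuousAt
      exact (continuousAt_const.clm_comp this).clm_comp continuousAt_const
    exact inter_mem (hΩ.mem_nhds hp₀)
      (hc (ContinuousLinearMap.isOpen_injective.mem_nhds hgood₀.2))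
  have hΨc : ∀ p ∈ Ω, ContDiffAt ℝ ∞ Ψ p := fun p hp =>
    (P.contDiff.contDiffAt.comp p (hFat p hp)).prodMk contDiffAt_snd
  have hΨd : ∀ p ∈ good, ∃ e : (X × T) ≃L[ℝ] (X × T),
      (e : X × T →L[ℝ] X × T) = (B p).prod (ContinuousLinearMap.snd ℝ X T) ∧
      HasFDerivAt Ψ (e : X × T →L[ℝ] X × T) p := by
    intro p hp
    obtain ⟨e, he⟩ := exists_continuousLinearEquiv_prod_snd (B p) hp.2
    refine ⟨e, he, ?_⟩
    rw [he]
    exact (P.hasFDerivAt.comp p (hFdiff p hp.1)).prodMk hasFDerivAt_snd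
  obtain ⟨e₀, -, he₀⟩ := hΨd _ hgood₀
  let Φ := (hΨc _ hp₀).toOpenPartialHomeomorph Ψ he₀ (by simp)
  have hΦ : ∀ p, Φ p = Ψ p := fun p => rfl
  have hsrc : (x₀, t₀) ∈ Φ.source := (hΨc _ hp₀).mem_toOpenPartialHomeomorph_source he₀ (by simp)
  constructor
  · refine ⟨{x | (x, t₀) ∈ Φ.source}, ?_, fun x hx y hy hxy => ?_⟩
    · exact (Continuous.prodMk_left t₀).continuousAt (Φ.open_source.mem_nhds hsrc)
    · have : Φ (x, t₀) = Φ (y, t₀) := by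
        simp only [hΦ, Ψ]
        rw [show F (x, t₀) = F (y, t₀) from hxy]
      exact congrArg Prod.fst (Φ.injOn hx hy this)
  have hnhds : Φ.target ∩ Φ.symm ⁻¹' good ∈ 𝓝 (P (F (x₀, t₀)), t₀) := by
    have htgt := Φ.map_source hsrc
    refine inter_mem (Φ.open_target.mem_nhds htgt) ?_
    have := Φ.continuousAt_symm htgt
    refine this ?_
    rw [Φ.left_inv hsrc]
    exact hgood
  obtain ⟨r, hr, hball⟩ := Metric.mem_nhds_iff.1 hnhds
  rw [← ball_prod_same] at hball
  set D := Metric.ball (P (F (x₀, t₀))) r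
  set D' := Metric.ball t₀ r
  have hsymm : ∀ q ∈ D ×ˢ D', ∃ e : (X × T) ≃L[ℝ] (X × T),
      (e : X × T →L[ℝ] X × T) = (B (Φ.symm q)).prod (ContinuousLinearMap.snd ℝ X T) ∧
      HasFDerivAt Φ.symm (e.symm : X × T →L[ℝ] X × T) q ∧ ContDiffAt ℝ ∞ Φ.symm q := by
    intro q hq
    obtain ⟨e, he, hd⟩ := hΨd _ (hball hq).2
    exact ⟨e, he, Φ.hasFDerivAt_symm (hball hq).1 hd,
      Φ.contDiffAt_symm (hball hq).1 hd (hΨc _ (hball hq).2.1)⟩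
  have hderiv : ∀ z ∈ D, ∀ t ∈ D',
      HasFDerivAt (fun s => F (Φ.symm (z, s))) (0 : T →L[ℝ] G) t := by
    intro z hz t ht
    obtain ⟨e, he, hd, -⟩ := hsymm (z, t) ⟨hz, ht⟩
    have hg := (hball (mk_mem_prod hz ht)).2
    have hcomp := ((hFdiff _ hg.1).comp (z, t) hd).comp t (hasFDerivAt_prodMk_right z t)
    refine hcomp.congr_fderiv ?_
    ext τ
    obtain ⟨ξ, τ', hξ⟩ : ∃ ξ τ', e.symm (0, τ) = (ξ, τ') := ⟨_, _, rfl⟩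
    have h1 : (e : X × T →L[ℝ] X × T) (ξ, τ') = (0, τ) := by
      rw [← hξ]; exact e.apply_symm_apply _
    rw [he] at h1
    simp only [ContinuousLinearMap.prod_apply, ContinuousLinearMap.coe_snd', Prod.mk.injEq] at h1
    obtain ⟨h1, rfl⟩ := h1
    obtain ⟨ξ', hξ'⟩ := htan _ hg.1 τ'
    have h2 : fderiv ℝ F (Φ.symm (z, t)) (ξ, τ') = fderiv ℝ F (Φ.symm (z, t)) (ξ + ξ', 0) := by
      rw [show ((ξ, τ') : X × T) = (ξ, 0) + (0, τ') by simp, map_add, hξ', ← map_add]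
      simp
    have h3 : ξ + ξ' = 0 := by
      apply hg.2
      simp only [B, ContinuousLinearMap.comp_apply, ContinuousLinearMap.inl_apply, map_zero]
      rw [← h2]
      exact h1
    have h4 : fderiv ℝ F (Φ.symm (z, t)) (ξ, τ') = 0 := by
      rw [h2, h3]; exact map_zero _
    simpa [hξ] using h4
  have hconst : ∀ z ∈ D, ∀ t ∈ D', F (Φ.symm (z, t)) = F (Φ.symm (z, t₀)) := by
    intro z hz t ht
    refine (convex_ball t₀ r).is_const_of_fderivWithin_eq_zero (𝕜 := ℝ)
      (f := fun s => F (Φ.symm (z, s)))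
      (fun s hs => (hderiv z hz s hs).differentiableAt.differentiableWithinAt) (fun s hs => ?_)
      ht (Metric.mem_ball_self hr)
    rw [fderivWithin_of_isOpen Metric.isOpen_ball hs, (hderiv z hz s hs).fderiv]
  refine ⟨fun p => (Φ.symm (P (F p), t₀)).1, ?_, ?_⟩
  · have : Φ.symm (P (F (x₀, t₀)), t₀) = (x₀, t₀) := Φ.left_inv hsrc
    simp only [this]
  · have hD : ∀ᶠ p in 𝓝 (x₀, t₀), Ψ p ∈ D ×ˢ D' :=
      (hΨc _ hp₀).continuousAt (prod_mem_nhds (Metric.ball_mem_nhds _ hr)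
        (Metric.ball_mem_nhds _ hr))
    filter_upwards [hD, hΩ.mem_nhds hp₀, Φ.open_source.mem_nhds hsrc] with p hp hpΩ hps
    have hp' : (P (F p), t₀) ∈ D ×ˢ D' := ⟨hp.1, Metric.mem_ball_self hr⟩
    constructor
    · obtain ⟨-, -, -, hc⟩ := hsymm _ hp'
      have hin : ContDiffAt ℝ ∞ (fun p => (P (F p), t₀)) p :=
        (P.contDiff.contDiffAt.comp p (hFat p hpΩ)).prodMk contDiffAt_const
      exact contDiffAt_fst.comp p (ContDiffAt.comp p hc hin)
    · have h1 : (Φ.symm (P (F p), t₀)).2 = t₀ :=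
        congrArg Prod.snd (Φ.right_inv (hball hp').1)
      have h2 : Φ.symm (P (F p), p.2) = p := Φ.left_inv hps
      have h3 := hconst _ hp.1 _ hp.2
      simp only [Ψ] at h3
      rw [h2] at h3
      have h4 : ((Φ.symm (P (F p), t₀)).1, t₀) = Φ.symm (P (F p), t₀) := Prod.ext rfl h1.symm
      exact (congrArg F h4).trans h3.symm

/-- Local reparametrizations glue over a neighbourhood of a compact set. -/
theorem exists_reparametrization_of_isCompact [FiniteDimensional ℝ G] {Ω : Set (X × T)}
    (hΩ : IsOpen Ω) {F : X × T → G} (hF : ContDiffOn ℝ ∞ F Ω)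
    (hinj : ∀ p ∈ Ω, Injective ((fderiv ℝ F p).comp (ContinuousLinearMap.inl ℝ X T)))
    (htan : ∀ p ∈ Ω, ∀ τ : T, ∃ ξ : X, fderiv ℝ F p (0, τ) = fderiv ℝ F p (ξ, 0))
    {t₀ : T} {U K : Set X} (hU : IsOpen U) (hUΩ : ∀ x ∈ U, (x, t₀) ∈ Ω) (hK : IsCompact K)
    (hKU : K ⊆ U) :
    ∃ φ : X × T → X, ∀ᶠ t in 𝓝 t₀, ∀ x ∈ K, ContDiffAt ℝ ∞ φ (x, t) ∧ φ (x, t) ∈ U ∧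
      F (x, t) = F (φ (x, t), t₀) ∧ (t = t₀ → φ (x, t) = x) := by
  have hloc := fun x (hx : x ∈ U) =>
    exists_local_reparametrization_s1 hΩ hF hinj htan (hUΩ x hx)
  obtain ⟨δ₀, hδ₀, hδ⟩ : ∃ δ > 0, ∀ x ∈ K, InjOn (fun x => F (x, t₀)) (Metric.ball x δ) := by
    choose! V hV hVinj using fun x hx => (hloc x hx).1
    obtain ⟨δ, hδ, h⟩ := lebesgue_number_lemma_of_metric
      (c := fun x : K => interior (V x)) hK (fun _ => isOpen_interior) fun x hx =>
        mem_iUnion.2 ⟨⟨x, hx⟩, mem_interior_iff_mem_nhds.2 (hV x (hKU hx))⟩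
    refine ⟨δ, hδ, fun x hx => ?_⟩
    obtain ⟨y, hy⟩ := h x hx
    exact (hVinj y (hKU y.2)).mono (hy.trans interior_subset)
  let Q : X × T → X → Prop := fun p y => y ∈ U ∧ dist y p.1 < δ₀ / 2 ∧ F (y, t₀) = F p
  have hex : ∀ p, ∃ y, (∃ z, Q p z) → Q p y := fun p => by
    by_cases h : ∃ z, Q p z
    · exact ⟨h.choose, fun _ => h.choose_spec⟩
    · exact ⟨p.1, fun h' => (h h').elim⟩
  choose φ hφ using hex
  refine ⟨φ, hK.eventually_forall_of_forall_eventually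
    (P := fun t x => ContDiffAt ℝ ∞ φ (x, t) ∧ φ (x, t) ∈ U ∧
      F (x, t) = F (φ (x, t), t₀) ∧ (t = t₀ → φ (x, t) = x)) fun x₀ hx₀ => ?_⟩
  suffices h : ∀ᶠ p in 𝓝 (x₀, t₀), ContDiffAt ℝ ∞ φ p ∧ φ p ∈ U ∧
      F p = F (φ p, t₀) ∧ (p.2 = t₀ → φ p = p.1) from
    (continuous_swap.tendsto (t₀, x₀)).eventually h
  obtain ⟨ψ, hψ₀, hψ⟩ := (hloc x₀ (hKU hx₀)).2
  have hψc : ContinuousAt ψ (x₀, t₀) := hψ.self_of_nhds.1.continuousAt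
  have hδ2 : 0 < δ₀ / 2 := half_pos hδ₀
  have hQψ : ∀ᶠ p in 𝓝 (x₀, t₀), Q p (ψ p) := by
    have h1 : ∀ᶠ p in 𝓝 (x₀, t₀), ψ p ∈ U :=
      hψc (by rw [hψ₀]; exact hU.mem_nhds (hKU hx₀))
    have h2 : ∀ᶠ p in 𝓝 (x₀, t₀), dist (ψ p) p.1 < δ₀ / 2 := by
      have : ContinuousAt (fun p : X × T => dist (ψ p) p.1) (x₀, t₀) :=
        hψc.dist continuousAt_fst
      exact this.eventually_lt continuousAt_const (by simpa [hψ₀] using hδ2)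
    filter_upwards [h1, h2, hψ] with p h1 h2 h3 using ⟨h1, h2, h3.2⟩
  have hnear : ∀ᶠ p : X × T in 𝓝 (x₀, t₀), p.1 ∈ U ∧ dist p.1 x₀ < δ₀ / 2 := by
    have h : ∀ᶠ x in 𝓝 x₀, x ∈ U ∧ dist x x₀ < δ₀ / 2 :=
      inter_mem (hU.mem_nhds (hKU hx₀)) (Metric.ball_mem_nhds x₀ hδ2)
    exact (continuous_fst.tendsto (x₀, t₀)).eventually h
  have huniq : ∀ p : X × T, dist p.1 x₀ < δ₀ / 2 → ∀ y z, Q p y → Q p z → y = z := by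
    intro p hp y z hy hz
    have hmem : ∀ w, Q p w → w ∈ Metric.ball x₀ δ₀ := fun w hw => by
      have := dist_triangle w p.1 x₀
      have := hw.2.1
      rw [Metric.mem_ball]
      linarith
    exact hδ x₀ hx₀ (hmem y hy) (hmem z hz) (hy.2.2.trans hz.2.2.symm)
  have heq : ∀ᶠ p in 𝓝 (x₀, t₀), φ p = ψ p := by
    filter_upwards [hQψ, hnear] with p h1 h2
    exact huniq p h2.2 _ _ (hφ p ⟨_, h1⟩) h1
  filter_upwards [heq.eventually_nhds, hψ, hQψ, hnear] with p h1 h2 h3 h4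
  have hQ := hφ p ⟨_, h3⟩
  refine ⟨h2.1.congr_of_eventuallyEq h1, hQ.1, hQ.2.2.symm, fun ht => ?_⟩
  refine huniq p h4.2 _ _ hQ ⟨h4.1, by simpa using hδ2, ?_⟩
  rw [← ht]

end TangentDeformation

/-- **Deformation along tangent directions, multi-parameter case.**
Let `U ⊆ ℝ^m` be open, `k ≥ m`, `l ≥ 1`, and `F : U × (−1,1)^l → ℝ^k` smooth. Suppose that at
every point of `U × (−1,1)^l` the partial derivatives `∂F/∂x₁, …, ∂F/∂x_m` are linearly
independent and each `∂F/∂t^j` lies in their span. Then for every open `U′` with compact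
closure contained in `U`, there are `ε ∈ (0,1)` and a smooth map
`φ : U′ × {|t| < ε} → U` with `φ(x,0) = x` and `F(x,t) = F(φ(x,t), 0)` for all `x ∈ U′`
and all `t ∈ (−1,1)^l` with `|t| < ε`. -/
theorem deformation_along_tangent_directions_multi {m k l : ℕ} (hmk : m ≤ k) (hl : 1 ≤ l)
    (U : Set (E m)) (hU : IsOpen U) (F : E m × E l → E k)
    (hF : ContDiffOn ℝ ∞ F (U ×ˢ {t : E l | ∀ j : Fin l, t j ∈ Set.Ioo (-1 : ℝ) 1}))
    (hind : ∀ x₀ ∈ U, ∀ t₀ ∈ {t : E l | ∀ j : Fin l, t j ∈ Set.Ioo (-1 : ℝ) 1},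
      LinearIndependent ℝ
        (fun i : Fin m => fderiv ℝ F (x₀, t₀) (EuclideanSpace.single i 1, 0)))
    (hspan : ∀ x₀ ∈ U, ∀ t₀ ∈ {t : E l | ∀ j : Fin l, t j ∈ Set.Ioo (-1 : ℝ) 1},
      ∀ j : Fin l,
        fderiv ℝ F (x₀, t₀) (0, EuclideanSpace.single j 1) ∈
          Submodule.span ℝ
            (Set.range fun i : Fin m =>
              fderiv ℝ F (x₀, t₀) (EuclideanSpace.single i 1, 0))) :
    ∀ U' : Set (E m), IsOpen U' → IsCompact (closure U') → closure U' ⊆ U →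
      ∃ ε ∈ Set.Ioo (0 : ℝ) 1, ∃ φ : E m × E l → E m,
        ContDiffOn ℝ ∞ φ (U' ×ˢ Metric.ball (0 : E l) ε) ∧
        (∀ x ∈ U', φ (x, 0) = x) ∧
        (∀ x ∈ U', ∀ t : E l, (∀ j : Fin l, t j ∈ Set.Ioo (-1 : ℝ) 1) → ‖t‖ < ε →
          φ (x, t) ∈ U ∧ F (x, t) = F (φ (x, t), 0)) := by
  intro U' _ hU'c hU'U
  set box : Set (E l) := {t : E l | ∀ j : Fin l, t j ∈ Set.Ioo (-1 : ℝ) 1} with hbox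
  have hboxo : IsOpen box := by
    simp only [hbox, ofPred_forall]
    exact isOpen_iInter_of_finite fun j => isOpen_Ioo.preimage (by fun_prop)
  have h0 : (0 : E l) ∈ box := fun j => by simp
  have hsum : ∀ {n : ℕ} (v : E n), v = ∑ i, v i • EuclideanSpace.single i (1 : ℝ) := fun v => by
    ext i
    simp [Finset.sum_apply, Pi.single_apply]
  have hinj : ∀ p ∈ U ×ˢ box,
      Injective ((fderiv ℝ F p).comp (ContinuousLinearMap.inl ℝ (E m) (E l))) := by
    rintro ⟨x, t⟩ ⟨hx, ht⟩
    rw [injective_iff_map_eq_zero]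
    intro v hv
    have := Fintype.linearIndependent_iff.1 (hind x hx t ht) v (by
      rw [hsum v, map_sum] at hv
      simpa only [map_smul, ContinuousLinearMap.comp_apply, ContinuousLinearMap.inl_apply]
        using hv)
    ext i
    exact this i
  have htan : ∀ p ∈ U ×ˢ box, ∀ τ : E l, ∃ ξ : E m,
      fderiv ℝ F p (0, τ) = fderiv ℝ F p (ξ, 0) := by
    rintro ⟨x, t⟩ ⟨hx, ht⟩ τ
    have hle : Submodule.span ℝ (Set.range fun i : Fin m =>
        fderiv ℝ F (x, t) (EuclideanSpace.single i 1, 0)) ≤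
        LinearMap.range ((fderiv ℝ F (x, t)).comp
          (ContinuousLinearMap.inl ℝ (E m) (E l))).toLinearMap := by
      rw [Submodule.span_le]
      rintro _ ⟨i, rfl⟩
      exact ⟨EuclideanSpace.single i 1, rfl⟩
    have hmem : fderiv ℝ F (x, t) (0, τ) ∈ LinearMap.range ((fderiv ℝ F (x, t)).comp
          (ContinuousLinearMap.inl ℝ (E m) (E l))).toLinearMap := by
      change (fderiv ℝ F (x, t)).comp (ContinuousLinearMap.inr ℝ (E m) (E l)) τ ∈ _
      rw [hsum τ, map_sum]
      refine Submodule.sum_mem _ fun j _ => ?_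
      rw [map_smul]
      exact Submodule.smul_mem _ _ (hle (hspan x hx t ht j))
    obtain ⟨ξ, hξ⟩ := hmem
    exact ⟨ξ, hξ.symm⟩
  obtain ⟨φ, hφ⟩ := exists_reparametrization_of_isCompact (hU.prod hboxo) hF hinj htan
    (t₀ := 0) hU (fun x hx => ⟨hx, h0⟩) hU'c hU'U
  obtain ⟨r, hr, hball⟩ := Metric.eventually_nhds_iff_ball.1 hφ
  have hmin : ∀ t : E l, ‖t‖ < min r (1 / 2) → t ∈ Metric.ball 0 r := fun t ht =>
    mem_ball_zero_iff.2 (ht.trans_le (min_le_left _ _))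
  have hpos : 0 < min r (1 / 2 : ℝ) := lt_min hr (by norm_num)
  refine ⟨min r (1 / 2), ⟨hpos, (min_le_right _ _).trans_lt (by norm_num)⟩, φ, ?_, ?_, ?_⟩
  · rintro ⟨x, t⟩ ⟨hx, ht⟩
    exact (hball t (hmin t (mem_ball_zero_iff.1 ht)) x
      (subset_closure hx)).1.contDiffWithinAt
  · intro x hx
    exact (hball 0 (Metric.mem_ball_self hr) x (subset_closure hx)).2.2.2 rfl
  · intro x hx t _ ht
    obtain ⟨-, h1, h2, -⟩ := hball t (hmin t ht) x (subset_closure hx)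
    exact ⟨h1, h2⟩
end
end
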